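/- Assume each ℓ_i is convex and L_i-smooth, σ_*² = (1/n)∑_i (ℓ_i′(a_i^⊤x_*))²‖a_i‖₂² is finite, and the permutations are uniformly random (random reshuffling: independent uniform π^{(k)} each epoch; or shuffle-once: one uniform permutation reused). Then for any fixed v ∈ ℝⁿ and any epoch k, the term 𝒯₂ := (η_k/n)∑_{i=1}^m (v_k^{(i)} − y_k^{(i)})^⊤A_k^{(i)}(x_k − x_{k−1,i}) satisfies E[𝒯₂] ≤ E[ (η_k³ n Ĥ L_{π^{(k)}} T̃L_{π^{(k)}}/b²)·‖y_k − y_{*,k}‖²_{Λ_k^{-1}} + (η_k/(2n))‖v_k − y_k‖²_{Λ_k^{-1}} ] + (η_k³ T̃L (n−b)(n+b))/(6b²(n−1)) · σ_*², where ĤL_π and T̃L_π denote the permutation-dependent smoothness constants L̂_π and L̃_π, and T̃L = max_π L̃_π. -/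

import Mathlib

open Finset Matrix

namespace SSGD

/-- squared Euclidean norm of a finite vector -/
noncomputable def sq {ι : Type*} [Fintype ι] (x : ι → ℝ) : ℝ := ∑ i, (x i) ^ 2

/-- Euclidean dot product -/
noncomputable def dot {ι : Type*} [Fintype ι] (x y : ι → ℝ) : ℝ := ∑ i, x i * y i

/-- weighted squared norm `‖u‖²_{(diag w)⁻¹} = ∑ i, (u i)² / w i` -/
noncomputable def wsq {ι : Type*} [Fintype ι] (w u : ι → ℝ) : ℝ := ∑ i, (u i) ^ 2 / w i

/-- operator (spectral) norm of a real matrix -/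
noncomputable def opNorm {α β : Type*} [Fintype α] [Fintype β] [DecidableEq β]
    (M : Matrix α β ℝ) : ℝ :=
  ‖LinearMap.toContinuousLinearMap (Matrix.toEuclideanLin M)‖

/-- `0`-based global index of the `j`-th element of the `i`-th batch of size `b` -/
def idx (b m : ℕ) (i : Fin m) (j : Fin b) : Fin (b * m) :=
  ⟨b * i.1 + j.1, by
    have hi : i.1 + 1 ≤ m := i.2
    have hj : j.1 < b := j.2
    calc b * i.1 + j.1 < b * i.1 + b := by omega
      _ = b * (i.1 + 1) := by ring
      _ ≤ b * m := Nat.mul_le_mul (le_refl b) hi⟩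

/-- `I_{j↑}` : the identity matrix with its first `j` diagonal entries zeroed out -/
noncomputable def Iup (n j : ℕ) : Matrix (Fin n) (Fin n) ℝ :=
  Matrix.diagonal fun i => if j ≤ i.1 then 1 else 0

/-- `I_{(j)}` (`j` 0-based) : diagonal matrix with ones exactly in positions
`b*j, …, b*(j+1)-1` -/
noncomputable def Iblk (n b j : ℕ) : Matrix (Fin n) (Fin n) ℝ :=
  Matrix.diagonal fun i => if b * j ≤ i.1 ∧ i.1 < b * (j + 1) then 1 else 0

variable {d b m : ℕ}

/-- the row-permuted data matrix `A_π` (row `i` of `A_π` is row `π i` of `A`) -/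
def permMat (A : Matrix (Fin (b * m)) (Fin d) ℝ) (π : Equiv.Perm (Fin (b * m))) :
    Matrix (Fin (b * m)) (Fin d) ℝ :=
  A.submatrix π id

/-- `Ĉ_π = (1/(m·n)) ‖W_π^{1/2} (∑_{j=1}^m I_{b(j-1)↑} A_π A_πᵀ I_{b(j-1)↑}) W_π^{1/2}‖₂`;
this is `L̂_π` for `w = L` and `Ĝ_π` for `w = G²`. -/
noncomputable def hatC (A : Matrix (Fin (b * m)) (Fin d) ℝ) (w : Fin (b * m) → ℝ)
    (π : Equiv.Perm (Fin (b * m))) : ℝ :=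
  (1 / ((m : ℝ) * ((b * m : ℕ) : ℝ))) * opNorm
    (Matrix.diagonal (fun i => Real.sqrt (w (π i))) *
      (∑ j : Fin m,
        Iup (b * m) (b * j.1) * (permMat A π * (permMat A π)ᵀ) * Iup (b * m) (b * j.1)) *
      Matrix.diagonal (fun i => Real.sqrt (w (π i))))

/-- `C̃_π = (1/b) ‖W_π^{1/2} (∑_{j=1}^m I_{(j)} A_π A_πᵀ I_{(j)}) W_π^{1/2}‖₂`;
this is `L̃_π` for `w = L` and `G̃_π` for `w = G²`. -/
noncomputable def tilC (A : Matrix (Fin (b * m)) (Fin d) ℝ) (w : Fin (b * m) → ℝ)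
    (π : Equiv.Perm (Fin (b * m))) : ℝ :=
  (1 / (b : ℝ)) * opNorm
    (Matrix.diagonal (fun i => Real.sqrt (w (π i))) *
      (∑ j : Fin m,
        Iblk (b * m) b j.1 * (permMat A π * (permMat A π)ᵀ) * Iblk (b * m) b j.1) *
      Matrix.diagonal (fun i => Real.sqrt (w (π i))))

/-- one inner (mini-batch) step of shuffled SGD, using the (sub)gradient selection `g` -/
noncomputable def step (A : Matrix (Fin (b * m)) (Fin d) ℝ) (g : Fin (b * m) → ℝ → ℝ)
    (η : ℝ) (π : Equiv.Perm (Fin (b * m))) (i : Fin m) (x : Fin d → ℝ) : Fin d → ℝ :=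
  fun t => x t - (η / (b : ℝ)) *
    ∑ j : Fin b, g (π (idx b m i j)) (dot (A (π (idx b m i j))) x) * A (π (idx b m i j)) t

/-- the primal iterates `x_{k-1,1}, …, x_{k-1,m+1}` within a single epoch
(`inIter A g η π x0 i` is `x_{k-1,i+1}`, so `inIter … 0 = x_{k-1}` and
`inIter … m = x_k`) -/
noncomputable def inIter (A : Matrix (Fin (b * m)) (Fin d) ℝ) (g : Fin (b * m) → ℝ → ℝ)
    (η : ℝ) (π : Equiv.Perm (Fin (b * m))) (x0 : Fin d → ℝ) : ℕ → Fin d → ℝ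
  | 0 => x0
  | i + 1 =>
    if h : i < m then step A g η π ⟨i, h⟩ (inIter A g η π x0 i) else inIter A g η π x0 i

/-- the dual vector `y_k` of one epoch, in permuted coordinates: its `p`-th entry is
`g_{π(p)}(a_{π(p)}ᵀ x_{k-1,i})` where `i` is the batch containing position `p` -/
noncomputable def dualY (A : Matrix (Fin (b * m)) (Fin d) ℝ) (g : Fin (b * m) → ℝ → ℝ)
    (η : ℝ) (π : Equiv.Perm (Fin (b * m))) (x0 : Fin d → ℝ) : Fin (b * m) → ℝ :=
  fun p => g (π p) (dot (A (π p)) (inIter A g η π x0 (p.1 / b)))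

/-- multi-epoch shuffled SGD: `xSeq A g η πs x0 k` is the iterate after `k` full epochs;
the (0-based) epoch `k` uses the permutation `πs k` and the step size `η k`. -/
noncomputable def xSeq (A : Matrix (Fin (b * m)) (Fin d) ℝ) (g : Fin (b * m) → ℝ → ℝ)
    (η : ℕ → ℝ) (πs : ℕ → Equiv.Perm (Fin (b * m))) (x0 : Fin d → ℝ) : ℕ → Fin d → ℝ
  | 0 => x0
  | k + 1 => inIter A g (η k) (πs k) (xSeq A g η πs x0 k) m

/-- the convex (Fenchel) conjugate of `f : ℝ → ℝ` -/
noncomputable def fconj (f : ℝ → ℝ) (y : ℝ) : ℝ := sSup (Set.range fun t => y * t - f t)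

/-- the Lagrangian `𝓛(x,y) = (1/n) ⟨A x, y⟩ - (1/n) ∑ᵢ ℓᵢ*(yⁱ)` -/
noncomputable def Lagr (A : Matrix (Fin (b * m)) (Fin d) ℝ) (ℓ : Fin (b * m) → ℝ → ℝ)
    (x : Fin d → ℝ) (y : Fin (b * m) → ℝ) : ℝ :=
  (1 / ((b * m : ℕ) : ℝ)) * ∑ i, dot (A i) x * y i
    - (1 / ((b * m : ℕ) : ℝ)) * ∑ i, fconj (ℓ i) (y i)

/-- `g` is a (global) subgradient of `f` at `t` -/
def IsSubgrad (f : ℝ → ℝ) (t g : ℝ) : Prop := ∀ s, f t + g * (s - t) ≤ f s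

/-- expectation with respect to the uniform distribution on a finite type -/
noncomputable def Eunif {α : Type*} [Fintype α] (F : α → ℝ) : ℝ :=
  (∑ a : α, F a) / (Fintype.card α : ℝ)

/-- extend a `K`-tuple of permutations to an `ℕ`-indexed sequence (by the identity) -/
def extSeq {K n : ℕ} (g : Fin K → Equiv.Perm (Fin n)) : ℕ → Equiv.Perm (Fin n) :=
  fun k => if h : k < K then g ⟨k, h⟩ else 1

theorem sum_idx (i : Fin m) (f : Fin (b * m) → ℝ) :
    ∑ j : Fin b, f (idx b m i j)
      = ∑ p : Fin (b * m), (if b * i.1 ≤ p.1 ∧ p.1 < b * (i.1 + 1) then 1 else 0) * f p := by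
  simp only [ite_mul, one_mul, zero_mul]
  rw [← Finset.sum_filter]
  refine Finset.sum_bij (fun j _ => idx b m i j) ?_ ?_ ?_ ?_
  · intro j _
    have hj := j.2
    simp only [Finset.mem_filter, Finset.mem_univ, true_and, idx]
    constructor
    · omega
    · rw [Nat.mul_succ]; omega
  · intro j _ j' _ h
    simp only [idx, Fin.mk.injEq] at h
    ext; omega
  · intro p hp
    simp only [Finset.mem_filter, Finset.mem_univ, true_and] at hp
    rw [Nat.mul_succ] at hp
    refine ⟨⟨p.1 - b * i.1, by omega⟩, Finset.mem_univ _, ?_⟩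
    ext
    simp only [idx]
    omega
  · intros; rfl

theorem dualY_idx (hb : 0 < b) (A : Matrix (Fin (b * m)) (Fin d) ℝ)
    (g : Fin (b * m) → ℝ → ℝ) (η : ℝ) (π : Equiv.Perm (Fin (b * m))) (x0 : Fin d → ℝ)
    (i : Fin m) (j : Fin b) :
    dualY A g η π x0 (idx b m i j)
      = g (π (idx b m i j)) (dot (A (π (idx b m i j))) (inIter A g η π x0 i.1)) := by
  have h : (idx b m i j).1 / b = i.1 := by
    simp only [idx]
    rw [Nat.mul_add_div hb, Nat.div_eq_of_lt j.2, add_zero]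
  simp only [dualY, h]

theorem inIter_eq (hb : 0 < b) (A : Matrix (Fin (b * m)) (Fin d) ℝ)
    (g : Fin (b * m) → ℝ → ℝ) (η : ℝ) (π : Equiv.Perm (Fin (b * m))) (x0 : Fin d → ℝ)
    (i : ℕ) (hi : i ≤ m) (t : Fin d) :
    inIter A g η π x0 i t = x0 t - (η / b) *
      ∑ p : Fin (b * m), (if p.1 < b * i then 1 else 0) * dualY A g η π x0 p * A (π p) t := by
  induction i with
  | zero => simp [inIter]
  | succ i ih =>
    have hi' : i < m := hi
    rw [inIter, dif_pos hi', step, ih hi'.le]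
    have h1 : ∑ j : Fin b, g (π (idx b m ⟨i, hi'⟩ j))
          (dot (A (π (idx b m ⟨i, hi'⟩ j))) (inIter A g η π x0 i)) * A (π (idx b m ⟨i, hi'⟩ j)) t
        = ∑ j : Fin b, (fun p => dualY A g η π x0 p * A (π p) t) (idx b m ⟨i, hi'⟩ j) := by
      refine Finset.sum_congr rfl fun j _ => ?_
      simp only [dualY_idx hb]
    rw [h1.trans (sum_idx ⟨i, hi'⟩ fun p => dualY A g η π x0 p * A (π p) t), sub_sub,
      ← mul_add, ← Finset.sum_add_distrib]
    congr 2
    refine Finset.sum_congr rfl fun p _ => ?_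
    have h2 : b * (i + 1) = b * i + b := Nat.mul_succ b i
    by_cases h3 : p.1 < b * i
    · have h4 : ¬ b * i ≤ p.1 := by omega
      have h5 : p.1 < b * (i + 1) := by omega
      simp [h3, h4, h5]
    · have h4 : b * i ≤ p.1 := by omega
      simp only [h3, h4, true_and, if_false]
      split_ifs <;> ring

theorem inIter_sub (hb : 0 < b) (A : Matrix (Fin (b * m)) (Fin d) ℝ)
    (g : Fin (b * m) → ℝ → ℝ) (η : ℝ) (π : Equiv.Perm (Fin (b * m))) (x0 : Fin d → ℝ)
    (i : Fin m) (t : Fin d) :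
    inIter A g η π x0 m t - inIter A g η π x0 i.1 t = - (η / b) *
      ∑ p : Fin (b * m), (if b * i.1 ≤ p.1 then 1 else 0) * dualY A g η π x0 p * A (π p) t := by
  rw [inIter_eq hb _ _ _ _ _ m le_rfl, inIter_eq hb _ _ _ _ _ i.1 i.2.le]
  have h : ∑ p : Fin (b * m), (if p.1 < b * m then 1 else 0) * dualY A g η π x0 p * A (π p) t
      = ∑ p : Fin (b * m), (if p.1 < b * i.1 then 1 else 0) * dualY A g η π x0 p * A (π p) t
      + ∑ p : Fin (b * m), (if b * i.1 ≤ p.1 then 1 else 0) * dualY A g η π x0 p * A (π p) t := by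
    rw [← Finset.sum_add_distrib]
    refine Finset.sum_congr rfl fun p _ => ?_
    rw [if_pos p.2]
    by_cases h3 : p.1 < b * i.1
    · have h4 : ¬ b * i.1 ≤ p.1 := by omega
      simp [h3, h4]
    · have h4 : b * i.1 ≤ p.1 := by omega
      simp [h3, h4]
  rw [h]
  ring

theorem dot_mulVec_le_opNorm {ι : Type*} [Fintype ι] [DecidableEq ι] (M : Matrix ι ι ℝ)
    (x : ι → ℝ) : x ⬝ᵥ (M *ᵥ x) ≤ opNorm M * sq x := by
  set T := LinearMap.toContinuousLinearMap (Matrix.toEuclideanLin M)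
  set X : EuclideanSpace ℝ ι := WithLp.toLp 2 x
  have h1 : inner ℝ X (T X) = x ⬝ᵥ (M *ᵥ x) := by
    simp only [PiLp.inner_apply, dotProduct]
    refine Finset.sum_congr rfl fun i _ => ?_
    simp [T, X, Matrix.toLpLin_apply, mul_comm]
  have h2 : ‖X‖ ^ 2 = sq x := by
    rw [EuclideanSpace.norm_sq_eq]
    simp [X, sq]
  rw [← h1, ← h2]
  calc inner ℝ X (T X) ≤ ‖X‖ * ‖T X‖ := real_inner_le_norm _ _
    _ ≤ ‖X‖ * (‖T‖ * ‖X‖) := by gcongr; exact T.le_opNorm X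
    _ = opNorm M * ‖X‖ ^ 2 := by simp only [opNorm, T]; ring

theorem sum_sq_le_opNorm {ι κ τ : Type*} [Fintype ι] [DecidableEq ι] [Fintype κ] [Fintype τ]
    (B : Matrix ι τ ℝ) (χ : κ → ι → ℝ) (w u : ι → ℝ) (hw : ∀ p, 0 < w p) :
    ∑ j, sq (fun t => ∑ p, χ j p * u p * B p t)
      ≤ opNorm (Matrix.diagonal (fun p => Real.sqrt (w p)) *
          (∑ j, Matrix.diagonal (χ j) * (B * Bᵀ) * Matrix.diagonal (χ j)) *
          Matrix.diagonal (fun p => Real.sqrt (w p))) * wsq w u := by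
  set D := Matrix.diagonal (fun p => Real.sqrt (w p))
  set x : ι → ℝ := fun p => u p / Real.sqrt (w p)
  have hx : sq x = wsq w u := by
    refine Finset.sum_congr rfl fun p _ => ?_
    simp only [x]
    rw [div_pow, Real.sq_sqrt (hw p).le]
  have hD : D *ᵥ x = u := by
    ext p
    have := (Real.sqrt_pos.2 (hw p)).ne'
    simp only [D, x, Matrix.mulVec_diagonal]
    field_simp
  have hD' : x ᵥ* D = u := by
    ext p
    have := (Real.sqrt_pos.2 (hw p)).ne'
    simp only [D, x, Matrix.vecMul_diagonal]
    field_simp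
  rw [← hx]
  refine le_trans (le_of_eq ?_) (dot_mulVec_le_opNorm _ x)
  rw [← Matrix.mulVec_mulVec, hD, ← Matrix.mulVec_mulVec, Matrix.dotProduct_mulVec, hD',
    Matrix.sum_mulVec, dotProduct_sum]
  refine Finset.sum_congr rfl fun j _ => ?_
  have h1 : Matrix.diagonal (χ j) *ᵥ u = fun p => χ j p * u p := by
    ext p; rw [Matrix.mulVec_diagonal]
  have h2 : u ᵥ* Matrix.diagonal (χ j) = fun p => χ j p * u p := by
    ext p; rw [Matrix.vecMul_diagonal, mul_comm]
  rw [← Matrix.mulVec_mulVec, h1, ← Matrix.mulVec_mulVec, Matrix.dotProduct_mulVec, h2,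
    ← Matrix.mulVec_mulVec, Matrix.dotProduct_mulVec, Matrix.mulVec_transpose]
  simp only [sq, dotProduct, Matrix.vecMul, pow_two]

theorem opNorm_nonneg {α β : Type*} [Fintype α] [Fintype β] [DecidableEq β]
    (M : Matrix α β ℝ) : 0 ≤ opNorm M := norm_nonneg _

theorem tilC_nonneg (A : Matrix (Fin (b * m)) (Fin d) ℝ) (w : Fin (b * m) → ℝ)
    (π : Equiv.Perm (Fin (b * m))) : 0 ≤ tilC A w π :=
  mul_nonneg (by positivity) (opNorm_nonneg _)

theorem sum_sq_block_le (hb : 0 < b) (A : Matrix (Fin (b * m)) (Fin d) ℝ)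
    (w : Fin (b * m) → ℝ) (hw : ∀ p, 0 < w p) (π : Equiv.Perm (Fin (b * m)))
    (u : Fin (b * m) → ℝ) :
    ∑ i : Fin m, sq (fun t => ∑ p : Fin (b * m),
        (if b * i.1 ≤ p.1 ∧ p.1 < b * (i.1 + 1) then 1 else 0) * u p * A (π p) t)
      ≤ b * tilC A w π * wsq (fun p => w (π p)) u := by
  have h := sum_sq_le_opNorm (permMat A π)
    (fun (i : Fin m) (p : Fin (b * m)) =>
      if b * i.1 ≤ p.1 ∧ p.1 < b * (i.1 + 1) then (1 : ℝ) else 0)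
    (fun p => w (π p)) u (fun p => hw _)
  have hb' : (b : ℝ) ≠ 0 := by positivity
  rw [tilC, ← mul_assoc, mul_one_div_cancel hb', one_mul]
  exact h

theorem sum_sq_tail_le (hb : 0 < b) (hm : 0 < m) (A : Matrix (Fin (b * m)) (Fin d) ℝ)
    (w : Fin (b * m) → ℝ) (hw : ∀ p, 0 < w p) (π : Equiv.Perm (Fin (b * m)))
    (u : Fin (b * m) → ℝ) :
    ∑ i : Fin m, sq (fun t => ∑ p : Fin (b * m),
        (if b * i.1 ≤ p.1 then 1 else 0) * u p * A (π p) t)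
      ≤ (m * (b * m : ℕ)) * hatC A w π * wsq (fun p => w (π p)) u := by
  have h := sum_sq_le_opNorm (permMat A π)
    (fun (i : Fin m) (p : Fin (b * m)) => if b * i.1 ≤ p.1 then (1 : ℝ) else 0)
    (fun p => w (π p)) u (fun p => hw _)
  have hb' : ((m : ℝ) * ((b * m : ℕ) : ℝ)) ≠ 0 := by positivity
  rw [hatC, ← mul_assoc, mul_one_div_cancel hb', one_mul]
  exact h

theorem neg_sum_dot_le {κ τ : Type*} [Fintype κ] [Fintype τ] (U Z : κ → τ → ℝ)
    {η t c W : ℝ} (hη : 0 < η) (ht : 0 ≤ t) (hc : 0 ≤ c) (hW : 0 ≤ W)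
    (hU : ∑ i, sq (U i) ≤ c * t * W) :
    - ∑ i, dot (U i) (Z i) ≤ η * t * ∑ i, sq (Z i) + c * W / (4 * η) := by
  have hZ : 0 ≤ ∑ i, sq (Z i) :=
    Finset.sum_nonneg fun i _ => Finset.sum_nonneg fun _ _ => sq_nonneg _
  refine le_trans (neg_le_abs _) (abs_le_of_sq_le_sq ?_ (by positivity))
  have h1 : (∑ i, dot (U i) (Z i)) ^ 2 ≤ (∑ i, sq (U i)) * ∑ i, sq (Z i) := by
    simp only [dot, sq, ← Finset.sum_product']
    exact Finset.sum_mul_sq_le_sq_mul_sq _ _ _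
  refine h1.trans ((mul_le_mul_of_nonneg_right hU hZ).trans ?_)
  have h2 : c * t * W * ∑ i, sq (Z i) = 4 * (η * t * ∑ i, sq (Z i)) * (c * W / (4 * η)) := by
    field_simp
  rw [h2]
  nlinarith [sq_nonneg (η * t * ∑ i, sq (Z i) - c * W / (4 * η))]

theorem wsq_nonneg {ι : Type*} [Fintype ι] {w : ι → ℝ} (hw : ∀ p, 0 < w p) (u : ι → ℝ) :
    0 ≤ wsq w u :=
  Finset.sum_nonneg fun p _ => div_nonneg (sq_nonneg _) (hw p).le

/-- First-order optimality of a minimizer of the finite-sum objective. -/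
theorem sum_deriv_mul_eq_zero {ι : Type*} [Fintype ι] (A : Matrix ι (Fin d) ℝ)
    (ℓ ℓ' : ι → ℝ → ℝ) (hderiv : ∀ i t, HasDerivAt (ℓ i) (ℓ' i t) t) (x : Fin d → ℝ)
    (hmin : ∀ z : Fin d → ℝ, ∑ i, ℓ i (dot (A i) x) ≤ ∑ i, ℓ i (dot (A i) z)) (t : Fin d) :
    ∑ i, ℓ' i (dot (A i) x) * A i t = 0 := by
  classical
  have hdot : ∀ i (s : ℝ), dot (A i) (x + s • Pi.single t 1) = dot (A i) x + s * A i t := by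
    intro i s
    simp [dot, mul_add, Finset.sum_add_distrib, Pi.single_apply, mul_comm]
  have hd : HasDerivAt (fun s : ℝ => ∑ i, ℓ i (dot (A i) x + s * A i t))
      (∑ i, ℓ' i (dot (A i) x) * A i t) 0 := by
    refine HasDerivAt.fun_sum fun i _ => ?_
    have h1 : HasDerivAt (fun s : ℝ => dot (A i) x + s * A i t) (A i t) 0 := by
      simpa using ((hasDerivAt_id (0 : ℝ)).mul_const (A i t)).const_add (dot (A i) x)
    have h2 : HasDerivAt (ℓ i) (ℓ' i (dot (A i) x)) (dot (A i) x + 0 * A i t) := by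
      simpa using hderiv i (dot (A i) x)
    exact h2.comp 0 h1
  refine IsLocalMin.hasDerivAt_eq_zero (Filter.Eventually.of_forall fun s => ?_) hd
  simp only [zero_mul, add_zero, ← hdot]
  exact hmin _

theorem sum_perm_apply {ι : Type*} [Fintype ι] [DecidableEq ι] (f : ι → ℝ) (p : ι) :
    (Fintype.card ι : ℝ) * ∑ π : Equiv.Perm ι, f (π p)
      = (Fintype.card (Equiv.Perm ι) : ℝ) * ∑ i, f i := by
  have h : ∀ q, ∑ π : Equiv.Perm ι, f (π q) = ∑ π : Equiv.Perm ι, f (π p) := by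
    intro q
    rw [← Equiv.sum_comp (Equiv.mulRight (Equiv.swap p q))]
    simp
  calc (Fintype.card ι : ℝ) * ∑ π : Equiv.Perm ι, f (π p)
      = ∑ q, ∑ π : Equiv.Perm ι, f (π q) := by simp [h]
    _ = ∑ π : Equiv.Perm ι, ∑ q, f (π q) := Finset.sum_comm
    _ = _ := by simp [Equiv.sum_comp]

theorem sum_perm_mul_apply {ι : Type*} [Fintype ι] [DecidableEq ι] (c : ι → ℝ)
    (hc : ∑ i, c i = 0) {p q : ι} (hpq : p ≠ q) :
    ((Fintype.card ι : ℝ) - 1) * ∑ π : Equiv.Perm ι, c (π p) * c (π q)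
      = - ∑ π : Equiv.Perm ι, c (π p) ^ 2 := by
  have h : ∀ r ∈ Finset.univ.erase p, ∑ π : Equiv.Perm ι, c (π p) * c (π r)
      = ∑ π : Equiv.Perm ι, c (π p) * c (π q) := by
    intro r hr
    have hr' : p ≠ r := (Finset.ne_of_mem_erase hr).symm
    rw [← Equiv.sum_comp (Equiv.mulRight (Equiv.swap q r))]
    simp [Equiv.swap_apply_of_ne_of_ne hpq hr']
  have h1 : ∑ r, ∑ π : Equiv.Perm ι, c (π p) * c (π r) = 0 := by
    rw [Finset.sum_comm]
    simp [← Finset.mul_sum, Equiv.sum_comp, hc]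
  rw [← Finset.add_sum_erase _ _ (Finset.mem_univ p), Finset.sum_congr rfl h, Finset.sum_const,
    Finset.card_erase_of_mem (Finset.mem_univ p), Finset.card_univ, nsmul_eq_mul,
    Nat.cast_sub (Fintype.card_pos_iff.2 ⟨p⟩), Nat.cast_one] at h1
  simp only [pow_two]
  linarith

/-- Second moment of the sum of a sample without replacement from a centred population. -/
theorem sum_perm_sq_sum {ι : Type*} [Fintype ι] [DecidableEq ι] (c : ι → ℝ)
    (hc : ∑ i, c i = 0) (S : Finset ι) :
    (Fintype.card ι : ℝ) * ((Fintype.card ι : ℝ) - 1)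
        * ∑ π : Equiv.Perm ι, (∑ p ∈ S, c (π p)) ^ 2
      = (Fintype.card (Equiv.Perm ι) : ℝ) * (S.card * ((Fintype.card ι : ℝ) - S.card))
        * ∑ i, c i ^ 2 := by
  set n : ℝ := (Fintype.card ι : ℝ)
  set N : ℝ := (Fintype.card (Equiv.Perm ι) : ℝ)
  have h1 : ∑ π : Equiv.Perm ι, (∑ p ∈ S, c (π p)) ^ 2
      = ∑ p ∈ S, ∑ q ∈ S, ∑ π : Equiv.Perm ι, c (π p) * c (π q) := by
    simp only [pow_two, Finset.sum_mul_sum]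
    rw [Finset.sum_comm]
    exact Finset.sum_congr rfl fun p _ => Finset.sum_comm
  have h2 : ∀ p ∈ S, n * (n - 1) * ∑ q ∈ S, ∑ π : Equiv.Perm ι, c (π p) * c (π q)
      = N * (n - S.card) * ∑ i, c i ^ 2 := by
    intro p hp
    have hD := sum_perm_apply (fun i => c i ^ 2) p
    have h3 : ∀ q ∈ S.erase p, n * (n - 1) * ∑ π : Equiv.Perm ι, c (π p) * c (π q)
        = - (N * ∑ i, c i ^ 2) := by
      intro q hq
      rw [mul_assoc, sum_perm_mul_apply c hc (Finset.ne_of_mem_erase hq).symm, mul_neg, hD]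
    rw [← Finset.add_sum_erase _ _ hp, mul_add, Finset.mul_sum (S.erase p),
      Finset.sum_congr rfl h3,
      Finset.sum_const, Finset.card_erase_of_mem hp, nsmul_eq_mul,
      Nat.cast_sub (Finset.card_pos.2 ⟨p, hp⟩), Nat.cast_one]
    simp only [← pow_two]
    linear_combination (n - 1) * hD
  rw [h1, Finset.mul_sum, Finset.sum_congr rfl h2, Finset.sum_const, nsmul_eq_mul]
  ring

theorem sum_mul_sub_range (m : ℕ) :
    ∑ i ∈ Finset.range m, (i : ℝ) * ((m : ℝ) - i) = (m : ℝ) * ((m : ℝ) - 1) * (m + 1) / 6 := by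
  have h : ∀ c : ℝ, ∑ i ∈ Finset.range m, (i : ℝ) * (c - i)
      = c * (m * (m - 1) / 2) - (m - 1) * m * (2 * m - 1) / 6 := by
    intro c
    induction m with
    | zero => simp
    | succ k ih => rw [Finset.sum_range_succ, ih]; push_cast; ring
  rw [h]
  ring

theorem card_tail (k n : ℕ) :
    (Finset.univ.filter fun p : Fin n => k ≤ p.1).card = n - k := by
  have h : (Finset.univ.filter fun p : Fin n => k ≤ p.1)
      = (Finset.univ.filter fun p : Fin n => p.1 < k)ᶜ := by
    ext p; simp
  rw [h, Finset.card_compl, Fin.card_filter_val_lt, Fintype.card_fin]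
  omega

/-- Average over uniform permutations of the squared norms of all batch-aligned tail sums. -/
theorem sum_perm_tail (hb : 0 < b) (hm : 0 < m) (A : Matrix (Fin (b * m)) (Fin d) ℝ)
    (y : Fin (b * m) → ℝ) (hy : ∀ t, ∑ i, y i * A i t = 0) :
    Eunif (fun π : Equiv.Perm (Fin (b * m)) => ∑ i : Fin m,
        sq (fun t => ∑ p : Fin (b * m), (if b * i.1 ≤ p.1 then 1 else 0) * y (π p) * A (π p) t))
      = (m * ((b * m : ℕ) - b) * ((b * m : ℕ) + b) / (6 * ((b * m : ℕ) - 1)))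
        * ((1 / ((b * m : ℕ) : ℝ)) * ∑ i, (y i) ^ 2 * sq (A i)) := by
  set n : ℝ := ((b * m : ℕ) : ℝ) with hn
  have hnbm : n = b * m := by rw [hn]; push_cast; ring
  have hn0 : n ≠ 0 := by rw [hn]; positivity
  rcases eq_or_ne n 1 with h1 | h1
  · have hbm : b * m = 1 := by rw [hn] at h1; exact_mod_cast h1
    have hb1 : b = 1 := Nat.eq_one_of_mul_eq_one_right hbm
    have hm1 : m = 1 := Nat.eq_one_of_mul_eq_one_left hbm
    have hz : ∀ (π : Equiv.Perm (Fin (b * m))) (i : Fin m),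
        sq (fun t => ∑ p : Fin (b * m), (if b * i.1 ≤ p.1 then 1 else 0) * y (π p) * A (π p) t)
          = 0 := by
      intro π i
      have hi : i.1 = 0 := by omega
      have : ∀ t, ∑ p, y (π p) * A (π p) t = 0 := fun t =>
        (Equiv.sum_comp π fun p => y p * A p t).trans (hy t)
      simp [sq, hi, this]
    have hnb : n - b = 0 := by rw [h1, hb1, Nat.cast_one, sub_self]
    simp only [Eunif, hz, hnb]
    simp
  · have hn1 : n - 1 ≠ 0 := sub_ne_zero.2 h1
    set N : ℝ := (Fintype.card (Equiv.Perm (Fin (b * m))) : ℝ) with hN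
    have hN0 : N ≠ 0 := by rw [hN]; exact_mod_cast Fintype.card_ne_zero
    have key : ∀ i : Fin m, ∑ π : Equiv.Perm (Fin (b * m)),
        sq (fun t => ∑ p : Fin (b * m), (if b * i.1 ≤ p.1 then 1 else 0) * y (π p) * A (π p) t)
          = (N * (b : ℝ) ^ 2 / (n * (n - 1)) * ∑ i, (y i) ^ 2 * sq (A i))
            * ((i.1 : ℝ) * ((m : ℝ) - i.1)) := by
      intro i
      have hle : b * i.1 ≤ b * m := Nat.mul_le_mul_left b i.2.le
      have h2 : ∀ t, ∑ π : Equiv.Perm (Fin (b * m)),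
          (∑ p : Fin (b * m), (if b * i.1 ≤ p.1 then 1 else 0) * y (π p) * A (π p) t) ^ 2
            = N * (b : ℝ) ^ 2 / (n * (n - 1)) * ((i.1 : ℝ) * ((m : ℝ) - i.1))
              * ∑ i, (y i * A i t) ^ 2 := by
        intro t
        have h3 := sum_perm_sq_sum (fun p => y p * A p t) (hy t)
          (Finset.univ.filter fun p : Fin (b * m) => b * i.1 ≤ p.1)
        rw [card_tail, Nat.cast_sub hle, Fintype.card_fin, ← hn, ← hN] at h3
        simp only [Finset.sum_filter] at h3
        simp only [ite_mul, one_mul, zero_mul]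
        rw [Nat.cast_mul] at h3
        generalize ∑ i, (y i * A i t) ^ 2 = V at h3 ⊢
        field_simp
        rw [mul_comm _ (n - 1), ← mul_assoc]
        rw [hnbm] at h3 ⊢
        linear_combination h3
      simp only [sq]
      rw [Finset.sum_comm, Finset.sum_congr rfl fun t _ => h2 t, ← Finset.mul_sum,
        Finset.sum_comm]
      simp only [mul_pow, ← Finset.mul_sum]
      ring
    rw [Eunif, Finset.sum_comm, Finset.sum_congr rfl fun i _ => key i, ← Finset.mul_sum,
      Fin.sum_univ_eq_sum_range (fun i : ℕ => (i : ℝ) * ((m : ℝ) - i)) m, sum_mul_sub_range,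
      ← hN, hnbm]
    rw [hnbm] at hn0 hn1
    have hb0 : (b : ℝ) ≠ 0 := by positivity
    have hm0 : (m : ℝ) ≠ 0 := by positivity
    field_simp

theorem Eunif_le_add {α : Type*} [Fintype α] [Nonempty α] {F G H : α → ℝ} {c e : ℝ}
    (h : ∀ a, F a ≤ G a + c * H a) (he : Eunif H = e) : Eunif F ≤ Eunif G + c * e := by
  rw [← he]
  simp only [Eunif]
  rw [mul_div_assoc', ← add_div, Finset.mul_sum, ← Finset.sum_add_distrib]
  gcongr with a
  exact h a

theorem Eunif_comp_eval {κ P : Type*} [Fintype κ] [DecidableEq κ] [Fintype P] [Nonempty P]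
    (F : P → ℝ) (k : κ) : Eunif (fun g : κ → P => F (g k)) = Eunif F := by
  classical
  let e := Equiv.funSplitAt k P
  have h1 : ∑ g : κ → P, F (g k) = ∑ x : P × ({j // j ≠ k} → P), F x.1 :=
    Fintype.sum_equiv e _ _ fun g => rfl
  have h2 : Fintype.card (κ → P) = Fintype.card (P × ({j // j ≠ k} → P)) := Fintype.card_congr e
  rw [Eunif, Eunif, h1, h2, Fintype.sum_prod_type, Fintype.card_prod]
  simp only [Finset.sum_const, nsmul_eq_mul, ← Finset.mul_sum, Nat.cast_mul, Finset.card_univ]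
  have h3 : (Fintype.card ({j // j ≠ k} → P) : ℝ) ≠ 0 := by
    exact_mod_cast Fintype.card_ne_zero
  rw [mul_comm (Fintype.card P : ℝ), mul_div_mul_left _ _ h3]

/-- Deterministic one-epoch bound on `𝒯₂`, with the tail sums of the optimal dual vector left
explicit. -/
theorem epoch_inner_le (hb : 0 < b) (hm : 0 < m) (A : Matrix (Fin (b * m)) (Fin d) ℝ)
    (g : Fin (b * m) → ℝ → ℝ) (L : Fin (b * m) → ℝ) (hL : ∀ i, 0 < L i)
    {η : ℝ} (hη : 0 < η) (v ystar : Fin (b * m) → ℝ) (π : Equiv.Perm (Fin (b * m)))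
    (x : Fin d → ℝ) :
    (η / ((b * m : ℕ) : ℝ)) * ∑ i : Fin m, ∑ j : Fin b,
        (v (π (idx b m i j)) - dualY A g η π x (idx b m i j))
          * dot (A (π (idx b m i j)))
              (fun t => inIter A g η π x m t - inIter A g η π x i.1 t)
      ≤ (η ^ 3 * ((b * m : ℕ) : ℝ) * hatC A L π * tilC A L π / (b : ℝ) ^ 2)
          * wsq (fun p => L (π p)) (fun p => dualY A g η π x p - ystar (π p))
        + (η / (2 * ((b * m : ℕ) : ℝ)))
          * wsq (fun p => L (π p)) (fun p => v (π p) - dualY A g η π x p)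
        + (η ^ 3 * (⨆ ρ : Equiv.Perm (Fin (b * m)), tilC A L ρ) / (b * ((b * m : ℕ) : ℝ)))
          * ∑ i : Fin m, sq (fun t => ∑ p : Fin (b * m),
              (if b * i.1 ≤ p.1 then 1 else 0) * ystar (π p) * A (π p) t) := by
  set n : ℝ := ((b * m : ℕ) : ℝ) with hn
  set Lt := ⨆ ρ : Equiv.Perm (Fin (b * m)), tilC A L ρ
  set y := dualY A g η π x
  set W := wsq (fun p => L (π p)) (fun p => v (π p) - y p)
  set W' := wsq (fun p => L (π p)) (fun p => y p - ystar (π p))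
  have hnbm : n = b * m := by rw [hn]; push_cast; ring
  have hb0 : (0 : ℝ) < b := by exact_mod_cast hb
  have hm0 : (0 : ℝ) < m := by exact_mod_cast hm
  have hn0 : 0 < n := by rw [hnbm]; positivity
  have hW : 0 ≤ W := wsq_nonneg (fun p => hL _) _
  have ht : 0 ≤ tilC A L π := tilC_nonneg _ _ _
  have htL : tilC A L π ≤ Lt := le_ciSup (Set.finite_range _).bddAbove π
  let U : Fin m → Fin d → ℝ := fun i t => ∑ p : Fin (b * m),
    (if b * i.1 ≤ p.1 ∧ p.1 < b * (i.1 + 1) then 1 else 0) * (v (π p) - y p) * A (π p) t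
  let Z : (Fin (b * m) → ℝ) → Fin m → Fin d → ℝ := fun u i t => ∑ p : Fin (b * m),
    (if b * i.1 ≤ p.1 then 1 else 0) * u p * A (π p) t
  have hU : ∑ i, sq (U i) ≤ b * tilC A L π * W := sum_sq_block_le hb A L hL π _
  have h1 := neg_sum_dot_le U (Z fun p => y p - ystar (π p)) hη ht hb0.le hW hU
  have h2 := neg_sum_dot_le U (Z fun p => ystar (π p)) hη ht hb0.le hW hU
  have hZ : ∑ i, sq (Z (fun p => y p - ystar (π p)) i) ≤ m * n * hatC A L π * W' :=
    sum_sq_tail_le hb hm A L hL π _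
  have hsplit : ∀ i : Fin m, ∑ j : Fin b, (v (π (idx b m i j)) - y (idx b m i j))
          * dot (A (π (idx b m i j)))
              (fun t => inIter A g η π x m t - inIter A g η π x i.1 t)
      = (η / b) * (- dot (U i) (Z (fun p => y p - ystar (π p)) i)
          + - dot (U i) (Z (fun p => ystar (π p)) i)) := by
    intro i
    have hz : ∀ t, inIter A g η π x m t - inIter A g η π x i.1 t
        = - (η / b) * (Z (fun p => y p - ystar (π p)) i t + Z (fun p => ystar (π p)) i t) := by
      intro t
      rw [inIter_sub hb]
      simp only [Z, ← Finset.sum_add_distrib]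
      congr 1
      refine Finset.sum_congr rfl fun p _ => ?_
      ring
    simp only [hz]
    generalize Z (fun p => y p - ystar (π p)) i = z₁
    generalize Z (fun p => ystar (π p)) i = z₂
    rw [sum_idx i (fun p => (v (π p) - y p)
      * dot (A (π p)) (fun t => - (η / b) * (z₁ t + z₂ t)))]
    simp only [dot, U, Finset.sum_mul, Finset.mul_sum, ← Finset.sum_neg_distrib,
      ← Finset.sum_add_distrib]
    rw [Finset.sum_comm]
    refine Finset.sum_congr rfl fun t _ => Finset.sum_congr rfl fun p _ => ?_
    ring
  rw [Finset.sum_congr rfl fun i _ => hsplit i, ← Finset.mul_sum, Finset.sum_add_distrib,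
    Finset.sum_neg_distrib, Finset.sum_neg_distrib]
  have hZ2 : 0 ≤ ∑ i, sq (Z (fun p => ystar (π p)) i) :=
    Finset.sum_nonneg fun i _ => Finset.sum_nonneg fun _ _ => sq_nonneg _
  change _ ≤ _ + η ^ 3 * Lt / (b * n) * ∑ i, sq (Z (fun p => ystar (π p)) i)
  calc _ ≤ η / n * (η / b * ((η * tilC A L π * (m * n * hatC A L π * W') + b * W / (4 * η))
        + (η * Lt * ∑ i, sq (Z (fun p => ystar (π p)) i) + b * W / (4 * η)))) := by
        have h3 := mul_le_mul_of_nonneg_left hZ (mul_nonneg hη.le ht)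
        have h4 := mul_le_mul_of_nonneg_right (mul_le_mul_of_nonneg_left htL hη.le) hZ2
        gcongr <;> linarith
    _ = _ := by
        rw [hnbm]
        field_simp
        ring

/-- **Lemma 3.3**: expected bound on the second inner-product term `𝒯₂` at any epoch `k`,
for random reshuffling (average over i.i.d. uniform permutation tuples) and for
shuffle-once (average over a single uniform permutation reused in every epoch). -/
theorem stmt2
    (b m d K : ℕ) (hb : 0 < b) (hm : 0 < m)
    (A : Matrix (Fin (b * m)) (Fin d) ℝ)
    (ℓ ℓ' : Fin (b * m) → ℝ → ℝ) (L : Fin (b * m) → ℝ)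
    (hL : ∀ i, 0 < L i)
    (hconv : ∀ i, ConvexOn ℝ Set.univ (ℓ i))
    (hderiv : ∀ i t, HasDerivAt (ℓ i) (ℓ' i t) t)
    (hsmooth : ∀ i s t, |ℓ' i s - ℓ' i t| ≤ L i * |s - t|)
    (xstar : Fin d → ℝ)
    (hmin : ∀ x : Fin d → ℝ,
      (1 / ((b * m : ℕ) : ℝ)) * ∑ i, ℓ i (dot (A i) xstar)
        ≤ (1 / ((b * m : ℕ) : ℝ)) * ∑ i, ℓ i (dot (A i) x))
    (η : ℕ → ℝ) (hη : ∀ k, 0 < η k)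
    (x0 : Fin d → ℝ) (v : Fin (b * m) → ℝ) (k : Fin K) :
    let n : ℝ := ((b * m : ℕ) : ℝ)
    let ystar : Fin (b * m) → ℝ := fun i => ℓ' i (dot (A i) xstar)
    let σ2 : ℝ := (1 / n) * ∑ i, (ystar i) ^ 2 * sq (A i)
    let Lt : ℝ := ⨆ π : Equiv.Perm (Fin (b * m)), tilC A L π
    let T2 : (ℕ → Equiv.Perm (Fin (b * m))) → ℝ := fun πs =>
      (η k.1 / n) * ∑ i : Fin m, ∑ j : Fin b,
        (v (πs k.1 (idx b m i j))
            - dualY A ℓ' (η k.1) (πs k.1) (xSeq A ℓ' η πs x0 k.1) (idx b m i j))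
          * dot (A (πs k.1 (idx b m i j)))
              (fun t => inIter A ℓ' (η k.1) (πs k.1) (xSeq A ℓ' η πs x0 k.1) m t
                      - inIter A ℓ' (η k.1) (πs k.1) (xSeq A ℓ' η πs x0 k.1) i.1 t)
    let RHS : (ℕ → Equiv.Perm (Fin (b * m))) → ℝ := fun πs =>
      ((η k.1) ^ 3 * n * hatC A L (πs k.1) * tilC A L (πs k.1) / (b : ℝ) ^ 2)
          * wsq (fun p => L (πs k.1 p))
              (fun p => dualY A ℓ' (η k.1) (πs k.1) (xSeq A ℓ' η πs x0 k.1) p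
                          - ystar (πs k.1 p))
        + (η k.1 / (2 * n))
          * wsq (fun p => L (πs k.1 p))
              (fun p => v (πs k.1 p)
                          - dualY A ℓ' (η k.1) (πs k.1) (xSeq A ℓ' η πs x0 k.1) p)
    let cst : ℝ :=
      ((η k.1) ^ 3 * Lt * (n - (b : ℝ)) * (n + (b : ℝ)) / (6 * (b : ℝ) ^ 2 * (n - 1))) * σ2
    (Eunif (fun g : Fin K → Equiv.Perm (Fin (b * m)) => T2 (extSeq g))
        ≤ Eunif (fun g : Fin K → Equiv.Perm (Fin (b * m)) => RHS (extSeq g)) + cst)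
    ∧ (Eunif (fun π0 : Equiv.Perm (Fin (b * m)) => T2 (fun _ => π0))
        ≤ Eunif (fun π0 : Equiv.Perm (Fin (b * m)) => RHS (fun _ => π0)) + cst) := by
  intro n ystar σ2 Lt T2 RHS cst
  have hn0 : 0 < n := by positivity
  have hopt : ∀ t, ∑ i, ystar i * A i t = 0 :=
    sum_deriv_mul_eq_zero A ℓ ℓ' hderiv xstar
      fun x => le_of_mul_le_mul_left (hmin x) (one_div_pos.2 hn0)
  let Q : Equiv.Perm (Fin (b * m)) → ℝ := fun π => ∑ i : Fin m, sq (fun t =>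
    ∑ p : Fin (b * m), (if b * i.1 ≤ p.1 then 1 else 0) * ystar (π p) * A (π p) t)
  have hQ : Eunif Q = (m * (n - b) * (n + b) / (6 * (n - 1))) * σ2 :=
    sum_perm_tail hb hm A ystar hopt
  have hpt : ∀ πs, T2 πs ≤ RHS πs + (η k.1 ^ 3 * Lt / (b * n)) * Q (πs k.1) := fun πs =>
    epoch_inner_le hb hm A ℓ' L hL (hη k.1) v ystar (πs k.1) (xSeq A ℓ' η πs x0 k.1)
  have hcst : cst
      = (η k.1 ^ 3 * Lt / (b * n)) * ((m * (n - b) * (n + b) / (6 * (n - 1))) * σ2) := by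
    have hnbm : n = b * m := by simp only [n]; push_cast; ring
    have hb0 : (b : ℝ) ≠ 0 := by positivity
    have hm0 : (m : ℝ) ≠ 0 := by positivity
    have h1 : η k.1 ^ 3 * Lt / (b * n) * m = η k.1 ^ 3 * Lt / (b : ℝ) ^ 2 := by
      rw [hnbm]; field_simp
    simp only [cst]
    rw [mul_comm 6 ((b : ℝ) ^ 2), mul_assoc, mul_assoc ((b : ℝ) ^ 2), mul_div_mul_comm, ← h1]
    ring
  rw [hcst]
  refine ⟨Eunif_le_add (H := fun g : Fin K → Equiv.Perm (Fin (b * m)) => Q (g k))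
    (fun g => ?_) ((Eunif_comp_eval Q k).trans hQ), Eunif_le_add (fun π => hpt fun _ => π) hQ⟩
  have h := hpt (extSeq g)
  have hk : extSeq g k.1 = g k := by simp [extSeq]
  rwa [hk] at h
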